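/- arXiv:1809.10848 — 2 statements merged into one kernel-verified Lean document; each statement's English description precedes it below -/
import Mathlib

section
/- Let f ∈ ℝ[x_1,...,x_n] with supp(f) = 𝒜, let ℬ = {ω_1,...,ω_r} ⊆ ℕ^n be the support set of a monomial basis, and let G(V_𝒜, E_𝒜) be the cross sparsity pattern graph. If i and j lie in the same connected component of G(V_𝒜, E_𝒜), then r^T ω_i ≡ r^T ω_j (mod 2) for every sign-symmetry r of f. Hence every connected component of the cross sparsity pattern graph is contained in a single sign-symmetry equivalence class of ℬ, i.e., the blocking decomposition obtained by cross sparsity patterns is a refinement of the block-diagonalization obtained by sign-symmetries. -/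
open scoped BigOperators

noncomputable section

/-- A sign-symmetry of `f` is a vector `s ∈ {0,1}^n` (encoded with entries in `ZMod 2`)
such that `sᵀ α ≡ 0 (mod 2)` for every exponent `α` in the support of `f`. -/
def IsSignSymmetry {n : ℕ} (f : MvPolynomial (Fin n) ℝ) (s : Fin n → ZMod 2) : Prop :=
  ∀ α ∈ f.support, ∑ i, s i * (α i : ZMod 2) = 0

/-- The inner product `sᵀ ω` modulo 2. -/
def dotMod2 {n : ℕ} (s : Fin n → ZMod 2) (ω : Fin n →₀ ℕ) : ZMod 2 :=
  ∑ i, s i * (ω i : ZMod 2)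

theorem dotMod2_add {n : ℕ} (s : Fin n → ZMod 2) (α β : Fin n →₀ ℕ) :
    dotMod2 s (α + β) = dotMod2 s α + dotMod2 s β := by
  simp [dotMod2, mul_add, Finset.sum_add_distrib]

/-- **Cross sparsity patterns refine sign-symmetries.**
Let `f ∈ ℝ[x]` with `supp f = 𝒜`, let `ℬ = {ω 1, ..., ω r}` be the support set of a
monomial basis, and let `G` be the cross sparsity pattern graph (edges `{i,j}`, `i ≠ j`,
whenever `ω i + ω j ∈ 𝒜 ∪ 2ℬ`).  If `i` and `j` lie in the same connected component of
`G` (i.e. are reachable from one another), then `sᵀ ω_i ≡ sᵀ ω_j (mod 2)` for every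
sign-symmetry `s` of `f`.  Hence every connected component of the cross sparsity pattern
graph is contained in a single sign-symmetry equivalence class of `ℬ`: the blocking
decomposition obtained by cross sparsity patterns refines the one from sign-symmetries. -/
theorem cross_sparsity_refines_sign_symmetry {n r : ℕ} (f : MvPolynomial (Fin n) ℝ)
    (𝒜 : Finset (Fin n →₀ ℕ)) (h𝒜 : f.support = 𝒜)
    (ω : Fin r → (Fin n →₀ ℕ)) (G : SimpleGraph (Fin r))
    (hG : ∀ i j, G.Adj i j ↔ i ≠ j ∧ (ω i + ω j ∈ 𝒜 ∨ ∃ k, ω i + ω j = ω k + ω k))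
    (i j : Fin r) (hreach : G.Reachable i j)
    (s : Fin n → ZMod 2) (hs : IsSignSymmetry f s) :
    dotMod2 s (ω i) = dotMod2 s (ω j) := by
  obtain ⟨p⟩ := hreach
  induction p with
  | nil => rfl
  | @cons u v w h _ ih =>
    refine Eq.trans ?_ ih
    rw [← CharTwo.add_eq_zero, ← dotMod2_add]
    obtain ⟨-, hmem | ⟨k, hk⟩⟩ := (hG u v).mp h
    · exact hs _ (h𝒜 ▸ hmem)
    · rw [hk, dotMod2_add, CharTwo.add_self_eq_zero]
end
end

section
/- If f ∈ ℝ[x_1,...,x_n] has an SOS decomposition f = Σ_{i=1}^m f_i², then for every i the Newton polytope of f_i is contained in one half of the Newton polytope of f, i.e., New(f_i) ⊆ ½ New(f). Consequently, supp(f_i) ⊆ conv({α/2 : α ∈ V(supp(f))}) ∩ ℕ^n for each i. -/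
open scoped BigOperators Pointwise

noncomputable section

/-- The embedding of an exponent vector `α ∈ ℕ^n` into `ℝ^n`. -/
def expVec {n : ℕ} (α : Fin n →₀ ℕ) : Fin n → ℝ := fun i => (α i : ℝ)

/-- A polytope is the convex hull of its vertices. -/
theorem convexHull_extremePoints_convexHull_of_finite {n : ℕ} {s : Set (Fin n → ℝ)}
    (hs : s.Finite) :
    convexHull ℝ (Set.extremePoints ℝ (convexHull ℝ s)) = convexHull ℝ s := by
  have hfin : (Set.extremePoints ℝ (convexHull ℝ s)).Finite :=
    hs.subset extremePoints_convexHull_subset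
  rw [← (hfin.isClosed_convexHull ℝ).closure_eq]
  exact closure_convexHull_extremePoints (hs.isCompact_convexHull ℝ) (convex_convexHull ℝ s)

theorem expVec_injective {n : ℕ} : Function.Injective (expVec (n := n)) := fun α β h =>
  Finsupp.ext fun i => by simpa [expVec] using congrFun h i

theorem expVec_add {n : ℕ} (α β : Fin n →₀ ℕ) : expVec (α + β) = expVec α + expVec β := by
  ext i
  simp [expVec]

/-- If `β` is a vertex of a set containing the support of `p`, then the coefficient of `p ^ 2` at
`2β` is the square of the coefficient of `p` at `β`. -/
theorem coeff_sq_of_mem_extremePoints {n : ℕ} {K : Set (Fin n → ℝ)}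
    {p : MvPolynomial (Fin n) ℝ} (hp : ∀ α ∈ p.support, expVec α ∈ K)
    {β : Fin n →₀ ℕ} (hβ : expVec β ∈ Set.extremePoints ℝ K) :
    (p ^ 2).coeff (β + β) = p.coeff β ^ 2 := by
  rw [sq, sq, MvPolynomial.coeff_mul]
  refine Finset.sum_eq_single (β, β) ?_ (by simp)
  rintro ⟨γ, δ⟩ hγδ hne
  by_contra h
  obtain ⟨hγ, hδ⟩ := mul_ne_zero_iff.1 h
  have hsum : γ + δ = β + β := Finset.HasAntidiagonal.mem_antidiagonal.1 hγδ
  have hmid : expVec β ∈ openSegment ℝ (expVec γ) (expVec δ) := by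
    refine ⟨1 / 2, 1 / 2, by norm_num, by norm_num, by norm_num, ?_⟩
    rw [← smul_add, ← expVec_add, hsum, expVec_add, ← two_smul ℝ, smul_smul]
    norm_num
  have hγβ : γ = β := expVec_injective <| hβ.2 (hp γ (MvPolynomial.mem_support_iff.2 hγ))
    (hp δ (MvPolynomial.mem_support_iff.2 hδ)) hmid
  subst hγβ
  exact hne (by rw [add_left_cancel hsum])

/-- The Newton polytopes of the summands of a sum of squares lie in half its Newton polytope. -/
theorem expVec_mem_half_convexHull_support_sum_sq {n m : ℕ}
    (g : Fin m → MvPolynomial (Fin n) ℝ) {i : Fin m} {β : Fin n →₀ ℕ} (hβ : β ∈ (g i).support) :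
    expVec β ∈ (2⁻¹ : ℝ) • convexHull ℝ
      (expVec '' ((∑ i, g i ^ 2).support : Set (Fin n →₀ ℕ))) := by
  set S : Set (Fin n →₀ ℕ) := ⋃ i, ((g i).support : Set (Fin n →₀ ℕ)) with hS
  have hfin : (expVec '' S).Finite :=
    (Set.finite_iUnion fun i => (g i).support.finite_toSet).image _
  have hmem : ∀ j, ∀ α ∈ (g j).support, expVec α ∈ convexHull ℝ (expVec '' S) :=
    fun j α hα => subset_convexHull ℝ _ ⟨α, Set.mem_iUnion.2 ⟨j, hα⟩, rfl⟩
  have hsub : convexHull ℝ (expVec '' S) ⊆ (2⁻¹ : ℝ) • convexHull ℝ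
      (expVec '' ((∑ i, g i ^ 2).support : Set (Fin n →₀ ℕ))) := by
    rw [← convexHull_extremePoints_convexHull_of_finite hfin]
    refine convexHull_min ?_ ((convex_convexHull ℝ _).smul _)
    intro v hv
    obtain ⟨γ, hγS, rfl⟩ := extremePoints_convexHull_subset hv
    obtain ⟨j, hj⟩ := Set.mem_iUnion.1 hγS
    refine ⟨expVec (γ + γ), subset_convexHull ℝ _ ⟨γ + γ, ?_, rfl⟩, ?_⟩
    · have hcoeff : (∑ i, g i ^ 2).coeff (γ + γ) = ∑ i, (g i).coeff γ ^ 2 := by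
        rw [MvPolynomial.coeff_sum]
        exact Finset.sum_congr rfl fun k _ => coeff_sq_of_mem_extremePoints (hmem k) hv
      rw [Finset.mem_coe, MvPolynomial.mem_support_iff, hcoeff]
      refine (Finset.sum_pos' (fun k _ => sq_nonneg _) ⟨j, Finset.mem_univ j, ?_⟩).ne'
      exact sq_pos_of_ne_zero (MvPolynomial.mem_support_iff.1 hj)
    · simp only [expVec_add, ← two_smul ℝ (expVec γ), smul_smul]
      norm_num
  exact hsub (hmem i β hβ)

/-- If `f = ∑ i, (g i)²` is an SOS decomposition of `f ∈ ℝ[x_1,...,x_n]`, then for every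
`i` the Newton polytope of `g i` is contained in one half of the Newton polytope of `f`,
`New(g i) ⊆ ½ New(f)`.  Consequently, the support of each `g i` is contained in
`conv({α/2 : α ∈ V(supp f)})` (intersected with `ℕ^n`, which is automatic). -/
theorem sos_newton_polytope_half {n m : ℕ} (f : MvPolynomial (Fin n) ℝ)
    (g : Fin m → MvPolynomial (Fin n) ℝ) (hf : f = ∑ i, (g i) ^ 2) :
    ∀ i,
      convexHull ℝ (expVec '' ((g i).support : Set (Fin n →₀ ℕ))) ⊆
        (2⁻¹ : ℝ) • convexHull ℝ (expVec '' (f.support : Set (Fin n →₀ ℕ))) ∧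
      ∀ β ∈ (g i).support,
        expVec β ∈ convexHull ℝ ((fun v => (2⁻¹ : ℝ) • v) ''
          Set.extremePoints ℝ (convexHull ℝ (expVec '' (f.support : Set (Fin n →₀ ℕ))))) := by
  intro i
  subst hf
  have hfin : (expVec '' ((∑ i, g i ^ 2).support : Set (Fin n →₀ ℕ))).Finite :=
    (Finset.finite_toSet _).image _
  refine ⟨convexHull_min ?_ ((convex_convexHull ℝ _).smul _), fun β hβ => ?_⟩
  · rintro _ ⟨β, hβ, rfl⟩
    exact expVec_mem_half_convexHull_support_sum_sq g hβ
  · rw [Set.image_smul, convexHull_smul, convexHull_extremePoints_convexHull_of_finite hfin]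
    exact expVec_mem_half_convexHull_support_sum_sq g hβ
end
end
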